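/- arXiv:2003.05547 — 2 statements merged into one kernel-verified Lean document; each statement's English description precedes it below -/
import Mathlib

section
/- Let n ≥ 2 be an integer and r ≥ 0 a real number. There exists a spherical code C in ℝ^n with maximal inner product cosh(2r)/(1 + cosh(2r)) such that |C| ≥ 2·B((n−1)/2, 1/2) / B((sech r)² − (sech r)⁴/4; (n−1)/2, 1/2). -/
open scoped RealInnerProductSpace

/-- The incomplete beta function `B(x; y, z) = ∫_0^x t^(y-1) (1-t)^(z-1) dt`;
the (complete) beta function is `B(y, z) = incBeta 1 y z`. -/
noncomputable def incBeta (x y z : ℝ) : ℝ :=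
  ∫ t in (0:ℝ)..x, t ^ (y - 1) * (1 - t) ^ (z - 1)

/-- A spherical code in `ℝ^n` with maximal inner product `t`: a finite set of
unit vectors whose pairwise inner products are at most `t`. -/
def IsSphericalCode (n : ℕ) (t : ℝ) (C : Finset (EuclideanSpace ℝ (Fin n))) : Prop :=
  (∀ x ∈ C, ‖x‖ = 1) ∧ ∀ x ∈ C, ∀ y ∈ C, x ≠ y → ⟪x, y⟫ ≤ t

open MeasureTheory Set

/-- Integration of a radial function in polar coordinates, for the lower Lebesgue integral. -/
theorem lintegral_fun_norm_addHaar {E : Type*} [NormedAddCommGroup E] [NormedSpace ℝ E]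
    [FiniteDimensional ℝ E] [Nontrivial E] [MeasurableSpace E] [BorelSpace E]
    (μ : Measure E) [μ.IsAddHaarMeasure] {f : ℝ → ENNReal} (hf : Measurable f) :
    ∫⁻ x, f ‖x‖ ∂μ = μ.toSphere univ *
      ∫⁻ y in Ioi (0 : ℝ), ENNReal.ofReal (y ^ (Module.finrank ℝ E - 1)) * f y := by
  have h1 : ∫⁻ x, f ‖x‖ ∂μ = ∫⁻ x : ({(0)}ᶜ : Set E), f ‖x.1‖ ∂(μ.comap (↑)) := by
    rw [lintegral_subtype_comap (measurableSet_singleton _).compl fun x ↦ f ‖x‖,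
      restrict_compl_singleton]
  have h2 : ∫⁻ x : ({(0)}ᶜ : Set E), f ‖x.1‖ ∂(μ.comap (↑)) =
      ∫⁻ x, f x.2 ∂μ.toSphere.prod (.volumeIoiPow (Module.finrank ℝ E - 1)) := by
    simpa using μ.measurePreserving_homeomorphUnitSphereProd.lintegral_comp_emb
        (Homeomorph.measurableEmbedding _) (f ∘ Subtype.val ∘ Prod.snd)
  rw [h1, h2, lintegral_prod _ (by fun_prop)]
  simp only [lintegral_const]
  rw [mul_comm]
  congr 1
  simp only [Measure.volumeIoiPow]
  rw [lintegral_withDensity_eq_lintegral_mul _ (by fun_prop) (by fun_prop)]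
  exact lintegral_subtype_comap measurableSet_Ioi fun a ↦
    ENNReal.ofReal (a ^ (Module.finrank ℝ E - 1)) * f a

/-- Any unit vector of `ℝ ^ (m + 1)` is the first axis of some
orthogonal splitting `ℝ × ℝ ^ m`. -/
theorem exists_linearIsometryEquiv_prod {m : ℕ} {x : EuclideanSpace ℝ (Fin (m + 1))}
    (hx : ‖x‖ = 1) :
    ∃ φ : EuclideanSpace ℝ (Fin (m + 1)) ≃ₗᵢ[ℝ] WithLp 2 (ℝ × EuclideanSpace ℝ (Fin m)),
      ∀ y, ⟪x, y⟫ = (φ y).fst := by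
  set e : WithLp 2 (ℝ × EuclideanSpace ℝ (Fin m)) := WithLp.toLp 2 (1, 0)
  have hen : ‖e‖ = 1 := by simp [e]
  have key : ∀ {V : Type} [NormedAddCommGroup V] [InnerProductSpace ℝ V]
      [FiniteDimensional ℝ V] (_ : Module.finrank ℝ V = m + 1) (v : V) (_ : ‖v‖ = 1),
      ∃ b : OrthonormalBasis (Fin (m + 1)) ℝ V, b 0 = v := by
    intro V _ _ _ hV v hv
    obtain ⟨b, hb⟩ := Orthonormal.exists_orthonormalBasis_extension_of_card_eq (𝕜 := ℝ)
      (ι := Fin (m + 1)) (by simp [hV]) (v := fun _ => v) (s := {0})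
      (by
        refine ⟨fun _ => by simpa using hv, fun i j hij => ?_⟩
        exact absurd (Subsingleton.elim i j) hij)
    exact ⟨b, hb 0 (by simp)⟩
  obtain ⟨b, hb⟩ := key (by simp) x hx
  have hfr : Module.finrank ℝ (WithLp 2 (ℝ × EuclideanSpace ℝ (Fin m))) = m + 1 := by
    rw [(WithLp.linearEquiv 2 ℝ (ℝ × EuclideanSpace ℝ (Fin m))).finrank_eq]
    simp [add_comm]
  obtain ⟨b', hb'⟩ := key hfr e hen
  refine ⟨b.equiv b' (Equiv.refl _), fun y => ?_⟩
  have hφ : b.equiv b' (Equiv.refl _) x = e := by rw [← hb, ← hb']; simp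
  rw [← (b.equiv b' (Equiv.refl _)).inner_map_map, hφ]
  simp [e, WithLp.prod_inner_apply]

/-- Volume of a body of revolution in `ℝ × ℝ ^ m`. -/
theorem volume_revolution {m : ℕ} (hm : 1 ≤ m) {T : Set (ℝ × ℝ)} (hT : MeasurableSet T) :
    volume {p : ℝ × EuclideanSpace ℝ (Fin m) | (p.1, ‖p.2‖) ∈ T} =
      (volume : Measure (EuclideanSpace ℝ (Fin m))).toSphere univ *
        ∫⁻ q : ℝ × ℝ, (Ioi (0 : ℝ)).indicator (fun ρ => ENNReal.ofReal (ρ ^ (m - 1))) q.2 *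
          T.indicator 1 q := by
  have : Nontrivial (EuclideanSpace ℝ (Fin m)) := by
    have : Nonempty (Fin m) := ⟨⟨0, hm⟩⟩
    infer_instance
  have hmeas : Measurable fun q : ℝ × ℝ =>
      (Ioi (0 : ℝ)).indicator (fun ρ => ENNReal.ofReal (ρ ^ (m - 1))) q.2 *
          T.indicator (1 : ℝ × ℝ → ENNReal) q :=
    (((by fun_prop : Measurable fun ρ : ℝ => ENNReal.ofReal (ρ ^ (m - 1))).indicator
      measurableSet_Ioi).comp measurable_snd).mul (measurable_one.indicator hT)
  have hS : MeasurableSet {p : ℝ × EuclideanSpace ℝ (Fin m) | (p.1, ‖p.2‖) ∈ T} :=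
    hT.preimage (by fun_prop : Measurable fun p : ℝ × EuclideanSpace ℝ (Fin m) => (p.1, ‖p.2‖))
  rw [Measure.volume_eq_prod, Measure.volume_eq_prod, Measure.prod_apply hS,
    lintegral_prod _ hmeas.aemeasurable, ← lintegral_const_mul _ hmeas.lintegral_prod_right']
  refine lintegral_congr fun a => ?_
  have hTa : MeasurableSet {ρ | (a, ρ) ∈ T} := hT.preimage measurable_prodMk_left
  have h := lintegral_fun_norm_addHaar (volume : Measure (EuclideanSpace ℝ (Fin m)))
    (f := {ρ | (a, ρ) ∈ T}.indicator 1) (measurable_one.indicator hTa)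
  rw [finrank_euclideanSpace_fin] at h
  have h0 : volume (Prod.mk a ⁻¹' {p : ℝ × EuclideanSpace ℝ (Fin m) | (p.1, ‖p.2‖) ∈ T}) =
      ∫⁻ v : EuclideanSpace ℝ (Fin m), {ρ | (a, ρ) ∈ T}.indicator (1 : ℝ → ENNReal) ‖v‖ := by
    rw [← lintegral_indicator_one (hS.preimage measurable_prodMk_left)]
    rfl
  rw [h0, h, ← lintegral_indicator measurableSet_Ioi]
  congr 1
  refine lintegral_congr fun ρ => ?_
  by_cases hρ : 0 < ρ <;> simp [indicator, hρ]

/-- Polar coordinates separate the integral over a planar circular sector. -/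
theorem lintegral_sector {m : ℕ} (hm : 1 ≤ m) (t : ℝ) :
    ∫⁻ q : ℝ × ℝ, (Ioi (0 : ℝ)).indicator (fun ρ => ENNReal.ofReal (ρ ^ (m - 1))) q.2 *
        {q : ℝ × ℝ | √(q.1 ^ 2 + q.2 ^ 2) < 1 ∧ t * √(q.1 ^ 2 + q.2 ^ 2) < q.1}.indicator 1 q =
      (∫⁻ R in Ioo (0 : ℝ) 1, ENNReal.ofReal (R ^ m)) *
        ∫⁻ φ in Ioo (0 : ℝ) Real.pi ∩ {φ | t < Real.cos φ},
          ENNReal.ofReal (Real.sin φ ^ (m - 1)) := by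
  have hA : MeasurableSet (Ioo (0 : ℝ) Real.pi ∩ {φ | t < Real.cos φ}) :=
    measurableSet_Ioo.inter (measurableSet_lt (by fun_prop) (by fun_prop))
  rw [← lintegral_comp_polarCoord_symm, ← lintegral_indicator measurableSet_Ioo,
    ← lintegral_indicator hA, ← lintegral_prod_mul, ← Measure.volume_eq_prod,
    ← lintegral_indicator polarCoord.open_target.measurableSet]
  rotate_left
  · exact ((by fun_prop : Measurable _).indicator measurableSet_Ioo).aemeasurable
  · exact ((by fun_prop : Measurable _).indicator hA).aemeasurable
  refine lintegral_congr fun ⟨R, φ⟩ => ?_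
  by_cases hR : 0 < R
  swap
  · simp [indicator, polarCoord_target, hR]
  have hsq : √((R * Real.cos φ) ^ 2 + (R * Real.sin φ) ^ 2) = R := by
    rw [show (R * Real.cos φ) ^ 2 + (R * Real.sin φ) ^ 2 = R ^ 2 by
      linear_combination R ^ 2 * Real.sin_sq_add_cos_sq φ, Real.sqrt_sq hR.le]
  have htR : t * R < R * Real.cos φ ↔ t < Real.cos φ := by
    rw [mul_comm t, mul_lt_mul_iff_right₀ hR]
  by_cases hφ : φ ∈ Ioo 0 Real.pi
  · have hsin := Real.sin_pos_of_mem_Ioo hφ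
    have hφ' : φ ∈ Ioo (-Real.pi) Real.pi := ⟨by linarith [hφ.1, Real.pi_pos], hφ.2⟩
    have hmul : ENNReal.ofReal R * ENNReal.ofReal ((R * Real.sin φ) ^ (m - 1)) =
        ENNReal.ofReal (R ^ m) * ENNReal.ofReal (Real.sin φ ^ (m - 1)) := by
      rw [← ENNReal.ofReal_mul hR.le, ← ENNReal.ofReal_mul (by positivity), mul_pow, ← mul_assoc,
        ← pow_succ', Nat.sub_add_cancel hm]
    by_cases h1 : R < 1 <;> by_cases h2 : t < Real.cos φ <;>
      simp [indicator, polarCoord_target, hR, hsq, htR, hφ.1, hφ.2, hφ'.1, hsin, hmul, h1, h2]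
  · have h0 : ¬ φ ∈ Ioo 0 Real.pi ∩ {φ | t < Real.cos φ} := fun h => hφ h.1
    rw [indicator_of_notMem (s := Ioo 0 Real.pi ∩ _) h0, mul_zero]
    by_cases hφ' : φ ∈ Ioo (-Real.pi) Real.pi
    · have hsin : Real.sin φ ≤ 0 := by
        refine Real.sin_nonpos_of_nonpos_of_neg_pi_le ?_ hφ'.1.le
        by_contra! h
        exact hφ ⟨h, hφ'.2⟩
      have : ¬ 0 < Real.sin φ := hsin.not_gt
      simp [indicator, hR, this]
    · rw [indicator_of_notMem]
      simp only [polarCoord_target, mem_prod, not_and]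
      exact fun _ => hφ'

/-- The part of the open unit ball lying in the open circular cone about the axis `x`
that consists of the vectors whose angle with `x` has cosine greater than `t`. -/
def ballCone {E : Type*} [NormedAddCommGroup E] [InnerProductSpace ℝ E] (x : E) (t : ℝ) : Set E :=
  {y | ‖y‖ < 1 ∧ t * ‖y‖ < ⟪x, y⟫}

theorem volume_ballCone {m : ℕ} (hm : 1 ≤ m) {x : EuclideanSpace ℝ (Fin (m + 1))}
    (hx : ‖x‖ = 1) (t : ℝ) :
    volume (ballCone x t) =
      ((volume : Measure (EuclideanSpace ℝ (Fin m))).toSphere univ *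
        ∫⁻ R in Ioo (0 : ℝ) 1, ENNReal.ofReal (R ^ m)) *
        ∫⁻ φ in Ioo (0 : ℝ) Real.pi ∩ {φ | t < Real.cos φ},
          ENNReal.ofReal (Real.sin φ ^ (m - 1)) := by
  obtain ⟨φ, hφ⟩ := exists_linearIsometryEquiv_prod hx
  have hT : MeasurableSet
      {q : ℝ × ℝ | √(q.1 ^ 2 + q.2 ^ 2) < 1 ∧ t * √(q.1 ^ 2 + q.2 ^ 2) < q.1} :=
    MeasurableSet.inter
      (s₁ := {q : ℝ × ℝ | √(q.1 ^ 2 + q.2 ^ 2) < 1})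
      (s₂ := {q : ℝ × ℝ | t * √(q.1 ^ 2 + q.2 ^ 2) < q.1})
      (measurableSet_lt (by fun_prop) (by fun_prop))
      (measurableSet_lt (by fun_prop) (by fun_prop))
  rw [mul_assoc, ← lintegral_sector hm, ← volume_revolution hm hT]
  have hmp := (WithLp.volume_preserving_ofLp ℝ (EuclideanSpace ℝ (Fin m))).comp
    φ.measurePreserving
  have hS := hT.preimage
    (by fun_prop : Measurable fun p : ℝ × EuclideanSpace ℝ (Fin m) => (p.1, ‖p.2‖))
  rw [← hmp.measure_preimage (s := {p | (p.1, ‖p.2‖) ∈ _}) hS.nullMeasurableSet]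
  congr 1
  ext y
  have hn : ‖y‖ = √((φ y).fst ^ 2 + ‖(φ y).snd‖ ^ 2) := by
    rw [← φ.norm_map, WithLp.prod_norm_eq_of_L2]; simp
  simp only [ballCone, mem_ofPred_eq, mem_preimage, Function.comp, hφ, hn]
  rfl

theorem lintegral_sin_pow {k : ℕ} {a : ℝ} (ha : 0 ≤ a) (ha' : a ≤ Real.pi) :
    ∫⁻ φ in Ioo (0 : ℝ) a, ENNReal.ofReal (Real.sin φ ^ k) =
      ENNReal.ofReal (∫ φ in (0 : ℝ)..a, Real.sin φ ^ k) := by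
  rw [intervalIntegral.integral_of_le ha, integral_Ioc_eq_integral_Ioo,
    ofReal_integral_eq_lintegral_ofReal]
  · exact ((by fun_prop : Continuous fun φ : ℝ => Real.sin φ ^ k).integrableOn_Icc (a := 0)
      (b := a)).mono_set Ioo_subset_Icc_self
  · filter_upwards [ae_restrict_mem measurableSet_Ioo] with φ hφ
    exact pow_nonneg (Real.sin_pos_of_mem_Ioo ⟨hφ.1, hφ.2.trans_le ha'⟩).le k

theorem integral_sin_pow_pi (k : ℕ) :
    ∫ φ in (0 : ℝ)..Real.pi, Real.sin φ ^ k =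
      2 * ∫ φ in (0 : ℝ)..(Real.pi / 2), Real.sin φ ^ k := by
  have hi : ∀ a b : ℝ, IntervalIntegrable (fun φ => Real.sin φ ^ k) volume a b := fun a b =>
    (by fun_prop : Continuous fun φ : ℝ => Real.sin φ ^ k).intervalIntegrable a b
  have h := intervalIntegral.integral_comp_sub_left (a := 0) (b := Real.pi / 2)
    (fun φ => Real.sin φ ^ k) Real.pi
  simp only [Real.sin_pi_sub, sub_zero, sub_half] at h
  rw [← intervalIntegral.integral_add_adjacent_intervals (hi 0 (Real.pi / 2)) (hi _ _), ← h]
  ring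

/-- The substitution `u = sin φ ^ 2` in the incomplete beta integral. -/
theorem incBeta_sin_sq {m : ℕ} (hm : 1 ≤ m) {θ : ℝ} (hθ : 0 ≤ θ) (hθ' : θ ≤ Real.pi / 2) :
    incBeta (Real.sin θ ^ 2) (m / 2) (1 / 2) =
      2 * ∫ φ in (0 : ℝ)..θ, Real.sin φ ^ (m - 1) := by
  have hmono : StrictMonoOn (fun φ => Real.sin φ ^ 2) (Icc 0 θ) := by
    intro a ha b hb hab
    have h1 : Real.sin a < Real.sin b := Real.strictMonoOn_sin
      ⟨by linarith [ha.1, Real.pi_pos], by linarith [ha.2]⟩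
      ⟨by linarith [hb.1, Real.pi_pos], by linarith [hb.2]⟩ hab
    have h2 : 0 ≤ Real.sin a :=
      Real.sin_nonneg_of_nonneg_of_le_pi ha.1 (by linarith [ha.2, Real.pi_pos])
    exact pow_lt_pow_left₀ h1 h2 two_ne_zero
  have himg : (fun φ => Real.sin φ ^ 2) '' Ioo 0 θ = Ioo 0 (Real.sin θ ^ 2) := by
    refine Subset.antisymm ?_ ?_
    · rintro _ ⟨φ, hφ, rfl⟩
      have h0 := hmono (left_mem_Icc.2 hθ) (Ioo_subset_Icc_self hφ) hφ.1
      have h1 := hmono (Ioo_subset_Icc_self hφ) (right_mem_Icc.2 hθ) hφ.2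
      exact ⟨by simpa using h0, h1⟩
    · have := intermediate_value_Ioo hθ (f := fun φ => Real.sin φ ^ 2) (by fun_prop)
      simpa using this
  have hderiv : ∀ φ ∈ Ioo 0 θ, HasDerivWithinAt (fun φ => Real.sin φ ^ 2)
      (2 * Real.sin φ * Real.cos φ) (Ioo 0 θ) φ := fun φ _ => by
    simpa using ((Real.hasDerivAt_sin φ).fun_pow 2).hasDerivWithinAt
  rw [incBeta, intervalIntegral.integral_of_le (sq_nonneg _), integral_Ioc_eq_integral_Ioo, ← himg,
    integral_image_eq_integral_abs_deriv_smul measurableSet_Ioo hderiv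
      (hmono.injOn.mono Ioo_subset_Icc_self),
    intervalIntegral.integral_of_le hθ, integral_Ioc_eq_integral_Ioo, ← integral_const_mul]
  refine setIntegral_congr_fun measurableSet_Ioo fun φ hφ => ?_
  have hs : 0 < Real.sin φ :=
    Real.sin_pos_of_mem_Ioo ⟨hφ.1, by linarith [hφ.2, Real.pi_pos]⟩
  have hc : 0 < Real.cos φ :=
    Real.cos_pos_of_mem_Ioo ⟨by linarith [hφ.1, Real.pi_pos], by linarith [hφ.2]⟩
  have e1 : (Real.sin φ ^ 2) ^ ((m : ℝ) / 2 - 1) * Real.sin φ = Real.sin φ ^ (m - 1) := by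
    rw [← Real.rpow_natCast _ 2, ← Real.rpow_mul hs.le, ← Real.rpow_add_one hs.ne',
      ← Real.rpow_natCast, Nat.cast_sub hm]
    congr 1
    push_cast
    ring
  have e2 : (1 - Real.sin φ ^ 2) ^ ((1 : ℝ) / 2 - 1) * Real.cos φ = 1 := by
    rw [← Real.cos_sq', ← Real.rpow_natCast _ 2, ← Real.rpow_mul hc.le, ← Real.rpow_add_one hc.ne']
    norm_num
  simp only [smul_eq_mul]
  rw [abs_of_pos (by positivity)]
  linear_combination 2 * Real.cos φ * (1 - Real.sin φ ^ 2) ^ ((1 : ℝ) / 2 - 1) * e1 +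
    2 * Real.sin φ ^ (m - 1) * e2

/-- If the open spherical caps of angular radius `θ` around the points of `C` cover the sphere,
then their areas add up to at least the area of the sphere. -/
theorem incBeta_le_card_mul_of_covering {m : ℕ} (hm : 1 ≤ m) {θ : ℝ} (hθ : 0 ≤ θ)
    (hθ' : θ ≤ Real.pi / 2) {C : Finset (EuclideanSpace ℝ (Fin (m + 1)))}
    (hC : ∀ x ∈ C, ‖x‖ = 1)
    (hcov : ∀ y : EuclideanSpace ℝ (Fin (m + 1)), ‖y‖ = 1 → ∃ x ∈ C, Real.cos θ < ⟪x, y⟫) :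
    2 * incBeta 1 (m / 2) (1 / 2) ≤
      C.card * incBeta (Real.sin θ ^ 2) (m / 2) (1 / 2) := by
  set K := (volume : Measure (EuclideanSpace ℝ (Fin m))).toSphere univ *
    ∫⁻ R in Ioo (0 : ℝ) 1, ENNReal.ofReal (R ^ m)
  have hpi := Real.pi_pos
  have hS (a : ℝ) (ha : 0 ≤ a) (ha' : a ≤ Real.pi) :
      Ioo (0 : ℝ) Real.pi ∩ {φ | Real.cos a < Real.cos φ} = Ioo 0 a := by
    ext φ
    constructor
    · rintro ⟨h1, h2⟩
      exact ⟨h1.1, (Real.strictAntiOn_cos.lt_iff_gt ⟨ha, ha'⟩ ⟨h1.1.le, h1.2.le⟩).1 h2⟩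
    · rintro ⟨h1, h2⟩
      have h3 : φ < Real.pi := h2.trans_le ha'
      exact ⟨⟨h1, h3⟩, (Real.strictAntiOn_cos.lt_iff_gt ⟨ha, ha'⟩ ⟨h1.le, h3.le⟩).2 h2⟩
  have hS2 : Ioo (0 : ℝ) Real.pi ∩ {φ | -2 < Real.cos φ} = Ioo 0 Real.pi :=
    inter_eq_left.2 fun φ _ => show -2 < Real.cos φ by linarith [Real.neg_one_le_cos φ]
  set I : ℝ → ℝ := fun a => ∫ φ in (0 : ℝ)..a, Real.sin φ ^ (m - 1)
  have hcone : ∀ x ∈ C, volume (ballCone x (Real.cos θ)) = K * ENNReal.ofReal (I θ) := by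
    intro x hx
    rw [volume_ballCone hm (hC x hx), hS θ hθ (by linarith), lintegral_sin_pow hθ (by linarith)]
  set e : EuclideanSpace ℝ (Fin (m + 1)) := EuclideanSpace.single 0 1
  have hball : volume (ballCone e (-2)) = K * ENNReal.ofReal (I Real.pi) := by
    rw [volume_ballCone hm (by simp [e]), hS2, lintegral_sin_pow hpi.le le_rfl]
  have hIpi : 0 < I Real.pi := integral_sin_pow_pos (m - 1)
  have hsub : ballCone e (-2) ⊆ ⋃ x ∈ C, ballCone x (Real.cos θ) := by
    rintro y ⟨hy1, hy2⟩
    have hy0 : y ≠ 0 := by rintro rfl; simp at hy2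
    have hny : 0 < ‖y‖ := norm_pos_iff.2 hy0
    obtain ⟨x, hx, hxy⟩ := hcov (‖y‖⁻¹ • y) (by simp [norm_smul, hny.ne'])
    simp only [mem_iUnion]
    refine ⟨x, hx, hy1, ?_⟩
    rw [inner_smul_right, inv_mul_eq_div, lt_div_iff₀ hny] at hxy
    exact hxy
  have hle : K * ENNReal.ofReal (I Real.pi) ≤ K * (C.card * ENNReal.ofReal (I θ)) := calc
    _ = volume (ballCone e (-2)) := hball.symm
    _ ≤ ∑ x ∈ C, volume (ballCone x (Real.cos θ)) :=
      (measure_mono hsub).trans (measure_biUnion_finset_le _ _)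
    _ = _ := by rw [Finset.sum_congr rfl hcone, Finset.sum_const, nsmul_eq_mul]; ring
  have hsup : ballCone e (-2) ⊆ Metric.ball 0 1 := fun y hy => by simpa using hy.1
  have hinf : Metric.ball 0 1 \ {0} ⊆ ballCone e (-2) := by
    rintro y ⟨hy1, hy0⟩
    refine ⟨by simpa using hy1, ?_⟩
    have hny : 0 < ‖y‖ := norm_pos_iff.2 hy0
    have h := neg_le_of_abs_le (abs_real_inner_le_norm e y)
    have hen : ‖e‖ = 1 := by simp [e]
    rw [hen] at h
    linarith
  have hK0 : K ≠ 0 := by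
    intro h
    rw [h, zero_mul] at hball
    have h1 := measure_mono_null hinf hball
    rw [measure_sdiff_null (measure_singleton _)] at h1
    exact (Metric.measure_ball_pos volume _ one_pos).ne' h1
  have hKtop : K ≠ ⊤ := by
    intro h
    rw [h, ENNReal.top_mul (by simpa using hIpi)] at hball
    exact ((measure_mono hsup).trans_lt measure_ball_lt_top).ne hball
  have hle2 := (ENNReal.mul_le_mul_iff_right hK0 hKtop).1 hle
  have hIθ : 0 ≤ I θ := intervalIntegral.integral_nonneg hθ fun φ hφ =>
    pow_nonneg (Real.sin_nonneg_of_nonneg_of_le_pi hφ.1 (by linarith [hφ.2])) _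
  rw [← ENNReal.ofReal_natCast, ← ENNReal.ofReal_mul (by positivity),
    ENNReal.ofReal_le_ofReal_iff (by positivity)] at hle2
  have h1 := incBeta_sin_sq hm (half_pos hpi).le le_rfl
  rw [Real.sin_pi_div_two, one_pow] at h1
  rw [h1, incBeta_sin_sq hm hθ hθ', ← integral_sin_pow_pi]
  linarith

/-- There is a spherical code that has at least `b` points or cannot be enlarged by a point. -/
theorem IsSphericalCode.exists_le_card_or_maximal {n : ℕ} {t : ℝ} (b : ℝ) :
    ∃ C, IsSphericalCode n t C ∧
      (b ≤ C.card ∨ ∀ y : EuclideanSpace ℝ (Fin n), ‖y‖ = 1 → y ∉ C → ∃ x ∈ C, t < ⟪x, y⟫) := by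
  by_contra! h
  have hex : ∀ k : ℕ, ∃ C, IsSphericalCode n t C ∧ C.card = k := by
    intro k
    induction k with
    | zero => exact ⟨∅, by simp [IsSphericalCode], rfl⟩
    | succ k ih =>
      obtain ⟨C, hC, hk⟩ := ih
      obtain ⟨-, y, hy, hyC, hy'⟩ := h C hC
      classical
      refine ⟨insert y C, ⟨?_, ?_⟩, by rw [Finset.card_insert_of_notMem hyC, hk]⟩
      · simpa [hy] using hC.1
      · intro u hu v hv huv
        rcases Finset.mem_insert.1 hu with rfl | hu' <;> rcases Finset.mem_insert.1 hv with rfl | hv'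
        · exact absurd rfl huv
        · rw [real_inner_comm]; exact hy' v hv'
        · exact hy' u hu'
        · exact hC.2 u hu' v hv' huv
  obtain ⟨C, hC, hk⟩ := hex ⌈b⌉₊
  exact absurd (Nat.le_ceil b) (not_le.2 (hk ▸ (h C hC).1))

/-- Theorem 2.4: lower bound for the kissing number in hyperbolic space,
in terms of spherical codes. -/
theorem lower_bound_kappa_H (n : ℕ) (hn : 2 ≤ n) (r : ℝ) (hr : 0 ≤ r) :
    ∃ C : Finset (EuclideanSpace ℝ (Fin n)),
      IsSphericalCode n (Real.cosh (2 * r) / (1 + Real.cosh (2 * r))) C ∧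
      2 * incBeta 1 ((n - 1) / 2) (1 / 2) /
          incBeta ((1 / Real.cosh r) ^ 2 - (1 / Real.cosh r) ^ 4 / 4) ((n - 1) / 2) (1 / 2)
        ≤ (C.card : ℝ) := by

  obtain ⟨m, rfl⟩ : ∃ m, n = m + 1 := ⟨n - 1, by omega⟩
  have hm : 1 ≤ m := by omega
  have hcosh : 1 ≤ Real.cosh r := Real.one_le_cosh r
  have h2r : Real.cosh (2 * r) = 2 * Real.cosh r ^ 2 - 1 := by
    rw [Real.cosh_two_mul, Real.sinh_sq]; ring
  set t := Real.cosh (2 * r) / (1 + Real.cosh (2 * r)) with ht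
  have ht' : t = 1 - (1 / Real.cosh r) ^ 2 / 2 := by
    rw [ht, h2r]; field_simp; ring
  have hs1 : (1 / Real.cosh r) ^ 2 ≤ 1 := pow_le_one₀ (by positivity) (by
    rw [div_le_one (by positivity)]; exact hcosh)
  have hs0 : 0 < (1 / Real.cosh r) ^ 2 := by positivity
  have ht0 : 0 ≤ t := by linarith
  have ht1 : t < 1 := by linarith
  have hθ : Real.arccos t ≤ Real.pi / 2 := Real.arccos_le_pi_div_two.2 ht0
  have hθ0 : 0 < Real.arccos t := Real.arccos_pos.2 ht1
  have hcos : Real.cos (Real.arccos t) = t := Real.cos_arccos (by linarith) ht1.le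
  have hsin : (1 / Real.cosh r) ^ 2 - (1 / Real.cosh r) ^ 4 / 4 = Real.sin (Real.arccos t) ^ 2 := by
    rw [Real.sin_sq, hcos, ht']; ring
  have hcast : (((m + 1 : ℕ) : ℝ) - 1) / 2 = m / 2 := by push_cast; ring
  rw [hsin, hcast]
  have hpos : 0 < incBeta (Real.sin (Real.arccos t) ^ 2) (m / 2) (1 / 2) := by
    rw [incBeta_sin_sq hm hθ0.le hθ]
    refine mul_pos two_pos (intervalIntegral.intervalIntegral_pos_of_pos_on
      ((by fun_prop : Continuous _).intervalIntegrable _ _) (fun φ hφ => ?_) hθ0)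
    exact pow_pos (Real.sin_pos_of_mem_Ioo
      ⟨hφ.1, by linarith [hφ.2, Real.pi_pos]⟩) _
  obtain ⟨C, hC, hC'⟩ := IsSphericalCode.exists_le_card_or_maximal (n := m + 1) (t := t)
    (2 * incBeta 1 (m / 2) (1 / 2) /
      incBeta (Real.sin (Real.arccos t) ^ 2) (m / 2) (1 / 2))
  refine ⟨C, hC, hC'.elim id fun hmax => ?_⟩
  rw [div_le_iff₀ hpos]
  refine incBeta_le_card_mul_of_covering hm hθ0.le hθ hC.1 fun y hy => ?_
  rw [hcos]
  by_cases hyC : y ∈ C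
  · exact ⟨y, hyC, by rw [real_inner_self_eq_norm_sq, hy]; simpa using ht1⟩
  · exact hmax y hy hyC
end

section
/- Let n ≥ 2 be an integer and r a real number with 0 ≤ r ≤ π/3. Every spherical code C in ℝ^n with maximal inner product cos(2r)/(1 + cos(2r)) satisfies |C| ≤ 2·B((sec r)²/4 · 0 + (n−1)/2, 1/2)⁻¹-free form: |C| ≤ 2·B((n−1)/2, 1/2) / B((sec r)²/4; (n−1)/2, 1/2). -/
open scoped RealInnerProductSpace

open MeasureTheory Set

/-- The volume of the sector of the unit ball with semi-angle `arcsin √x` in dimension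
`m + 1`, relative to the unit ball in dimension `m`. -/
noncomputable def sectorVolume (m : ℕ) (x : ℝ) : ℝ :=
  √x ^ m * √(1 - x) / (m + 1) + ∫ s in √(1 - x)..1, √(1 - s ^ 2) ^ m

theorem continuous_sqrt_one_sub_sq_pow (m : ℕ) :
    Continuous fun s : ℝ => √(1 - s ^ 2) ^ m := by fun_prop

theorem continuous_sectorVolume (m : ℕ) : Continuous (sectorVolume m) := by
  have h := continuous_sqrt_one_sub_sq_pow m
  have h1 : Continuous fun u : ℝ => ∫ s in u..1, √(1 - s ^ 2) ^ m := by
    simp_rw [fun u : ℝ => intervalIntegral.integral_symm (μ := volume)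
      (f := fun s : ℝ => √(1 - s ^ 2) ^ m) 1 u]
    exact (intervalIntegral.continuous_primitive (fun a b => h.intervalIntegrable a b) 1).neg
  have h2 : Continuous fun x : ℝ => √(1 - x) := by fun_prop
  have h3 : Continuous fun x : ℝ => √x ^ m * √(1 - x) / (m + 1) := by fun_prop
  exact h3.add (h1.comp h2)

theorem hasDerivAt_sectorVolume (k : ℕ) {x : ℝ} (hx : x ∈ Ioo (0 : ℝ) 1) :
    HasDerivAt (sectorVolume (k + 1))
      ((k + 1) / (2 * (k + 2)) * (x ^ ((k + 1 : ℝ) / 2 - 1) * (1 - x) ^ ((1 : ℝ) / 2 - 1))) x := by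
  obtain ⟨h0, h1⟩ := hx
  have h1' : 0 < 1 - x := by linarith
  have hc := continuous_sqrt_one_sub_sq_pow (k + 1)
  have hs := Real.hasDerivAt_sqrt h0.ne'
  have hs' := ((hasDerivAt_id x).const_sub 1).sqrt h1'.ne'
  have hI := (intervalIntegral.integral_hasDerivAt_left (hc.intervalIntegrable (√(1 - x)) 1)
    (hc.stronglyMeasurableAtFilter _ _) hc.continuousAt).comp x hs'
  have key := (((hs.pow (k + 1)).mul hs').div_const (((k + 1 : ℕ) : ℝ) + 1)).add hI
  refine key.congr_deriv ?_
  have ha : 0 < √x := Real.sqrt_pos.2 h0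
  have hb : 0 < √(1 - x) := Real.sqrt_pos.2 h1'
  have e1 : x ^ ((k + 1 : ℝ) / 2 - 1) = √x ^ (k + 1) / √x ^ 2 := by
    rw [Real.rpow_sub h0, Real.rpow_one, Real.sq_sqrt h0.le, Real.sqrt_eq_rpow,
      ← Real.rpow_natCast, ← Real.rpow_mul h0.le]
    congr 2
    push_cast
    ring
  have e2 : (1 - x) ^ ((1 : ℝ) / 2 - 1) = √(1 - x) / √(1 - x) ^ 2 := by
    rw [Real.rpow_sub h1', Real.rpow_one, Real.sq_sqrt h1'.le, Real.sqrt_eq_rpow]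
  have e3 : √(1 - √(1 - x) ^ 2) = √x := by
    rw [Real.sq_sqrt h1'.le]; congr 1; ring
  have e4 : √(1 - x) ^ 2 = 1 - √x ^ 2 := by
    rw [Real.sq_sqrt h1'.le, Real.sq_sqrt h0.le]
  rw [e1, e2]
  simp only [id, e3, Nat.add_sub_cancel, Pi.pow_apply]
  push_cast
  generalize √x = a at *
  generalize √(1 - x) = b at *
  have hk : (k : ℝ) + 2 ≠ 0 := by positivity
  have hk' : (k : ℝ) + 1 + 1 ≠ 0 := by positivity
  field_simp
  rw [e4]
  ring

theorem beta_integrand_intervalIntegrable (k : ℕ) {x : ℝ} (hx0 : 0 ≤ x) (hx1 : x ≤ 1) :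
    IntervalIntegrable (fun t : ℝ => t ^ ((k + 1 : ℝ) / 2 - 1) * (1 - t) ^ ((1 : ℝ) / 2 - 1))
      volume 0 x := by
  have hk : (0 : ℝ) < (k + 1) / (2 * (k + 2)) := by positivity
  have h := intervalIntegral.integrableOn_deriv_of_nonneg (a := 0) (b := x)
    (continuous_sectorVolume (k + 1)).continuousOn
    (fun t ht => hasDerivAt_sectorVolume k ⟨ht.1, ht.2.trans_le hx1⟩)
    (fun t ht => by
      have h1 : 0 ≤ t := ht.1.le
      have h2 : 0 ≤ 1 - t := by linarith [ht.2]
      positivity)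
  rw [intervalIntegrable_iff_integrableOn_Ioc_of_le hx0]
  refine (h.const_mul (((k + 1 : ℝ) / (2 * (k + 2)))⁻¹)).congr (.of_forall fun t => ?_)
  exact inv_mul_cancel_left₀ hk.ne' _

theorem sectorVolume_eq_incBeta (k : ℕ) {x : ℝ} (hx0 : 0 ≤ x) (hx1 : x ≤ 1) :
    sectorVolume (k + 1) x = (k + 1) / (2 * (k + 2)) * incBeta x ((k + 1) / 2) (1 / 2) := by
  have h := intervalIntegral.integral_eq_sub_of_hasDerivAt_of_le hx0
    (continuous_sectorVolume (k + 1)).continuousOn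
    (fun t ht => hasDerivAt_sectorVolume k ⟨ht.1, ht.2.trans_le hx1⟩)
    ((beta_integrand_intervalIntegrable k hx0 hx1).const_mul _)
  rw [intervalIntegral.integral_const_mul] at h
  have h0 : sectorVolume (k + 1) 0 = 0 := by simp [sectorVolume]
  rw [incBeta, h, h0, sub_zero]

theorem incBeta_pos (k : ℕ) {x : ℝ} (hx0 : 0 < x) (hx1 : x ≤ 1) :
    0 < incBeta x ((k + 1) / 2) (1 / 2) := by
  refine intervalIntegral.intervalIntegral_pos_of_pos_on
    (beta_integrand_intervalIntegrable k hx0.le hx1) (fun t ht => ?_) hx0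
  have h1 : 0 < t := ht.1
  have h2 : 0 < 1 - t := by linarith [ht.2]
  positivity

/-- Splitting off the coordinate along a unit vector preserves the volume. -/
theorem exists_measurePreserving_split (m : ℕ) (u : EuclideanSpace ℝ (Fin (m + 1)))
    (hu : ‖u‖ = 1) :
    ∃ φ : EuclideanSpace ℝ (Fin (m + 1)) → ℝ × EuclideanSpace ℝ (Fin m),
      MeasurePreserving φ ∧
        ∀ x, (φ x).1 = ⟪u, x⟫ ∧ ‖x‖ ^ 2 = (φ x).1 ^ 2 + ‖(φ x).2‖ ^ 2 := by
  obtain ⟨b, hb⟩ := Orthonormal.exists_orthonormalBasis_extension_of_card_eq (𝕜 := ℝ)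
    (E := EuclideanSpace ℝ (Fin (m + 1))) (ι := Fin (m + 1)) (by simp) (v := fun _ => u)
    (s := {0}) (by
      constructor
      · intro i; simpa using hu
      · intro i j hij; exact absurd (Subsingleton.elim i j) hij)
  have hb0 : b 0 = u := hb 0 rfl
  have hφ := (((MeasurePreserving.id (volume : Measure ℝ)).prod
    (PiLp.volume_preserving_toLp (Fin m))).comp
    (volume_preserving_piFinSuccAbove (fun _ : Fin (m + 1) => ℝ) 0)).comp
    ((PiLp.volume_preserving_ofLp (Fin (m + 1))).comp b.measurePreserving_repr)
  refine ⟨_, hφ, fun x => ⟨?_, ?_⟩⟩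
  · simp [MeasurableEquiv.piFinSuccAbove, ← hb0, b.repr_apply_apply]
  · rw [← b.repr.norm_map x, EuclideanSpace.real_norm_sq_eq, EuclideanSpace.real_norm_sq_eq,
      Fin.sum_univ_succ]
    simp [MeasurableEquiv.piFinSuccAbove, Fin.tail]

theorem lintegral_volume_ball (k : ℕ) {a b : ℝ} (hab : a ≤ b) {ρ : ℝ → ℝ} (hρ : Continuous ρ)
    (h0 : ∀ s ∈ Ioc a b, 0 ≤ ρ s) :
    ∫⁻ s in Ioc a b, volume (Metric.ball (0 : EuclideanSpace ℝ (Fin (k + 1))) (ρ s)) =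
      ENNReal.ofReal (∫ s in a..b, ρ s ^ (k + 1)) *
        volume (Metric.ball (0 : EuclideanSpace ℝ (Fin (k + 1))) 1) := by
  have hc : Continuous fun s => ρ s ^ (k + 1) := by fun_prop
  rw [intervalIntegral.integral_of_le hab, ofReal_integral_eq_lintegral_ofReal
    ((intervalIntegrable_iff_integrableOn_Ioc_of_le hab).1 (hc.intervalIntegrable a b))
    ((ae_restrict_iff' measurableSet_Ioc).2 (.of_forall fun s hs => pow_nonneg (h0 s hs) _)),
    ← lintegral_mul_const _ (by fun_prop)]
  refine setLIntegral_congr_fun measurableSet_Ioc fun s hs => ?_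
  simp only [Measure.addHaar_ball volume _ (h0 s hs), finrank_euclideanSpace, Fintype.card_fin]

/-- The part of the open unit ball inside the circular cone around `u` with semi-angle
`arccos c`. -/
def ballSector (n : ℕ) (c : ℝ) (u : EuclideanSpace ℝ (Fin n)) : Set (EuclideanSpace ℝ (Fin n)) :=
  {x | c * ‖x‖ < ⟪u, x⟫ ∧ ‖x‖ < 1}

theorem measurableSet_ballSector (n : ℕ) (c : ℝ) (u : EuclideanSpace ℝ (Fin n)) :
    MeasurableSet (ballSector n c u) := by
  refine ((isOpen_lt ?_ ?_).and (isOpen_lt ?_ ?_)).measurableSet <;> fun_prop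

theorem ofReal_sectorVolume_mul_le (k : ℕ) {x : ℝ} (hx0 : 0 ≤ x) (hx1 : x ≤ 1)
    {u : EuclideanSpace ℝ (Fin (k + 2))} (hu : ‖u‖ = 1) :
    ENNReal.ofReal (sectorVolume (k + 1) x) *
        volume (Metric.ball (0 : EuclideanSpace ℝ (Fin (k + 1))) 1) ≤
      volume (ballSector (k + 2) √(1 - x) u) := by
  set c := √(1 - x) with hc
  have hc0 : 0 ≤ c := Real.sqrt_nonneg _
  have hc2 : c ^ 2 = 1 - x := Real.sq_sqrt (by linarith)
  have hc1 : c ≤ 1 := by nlinarith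
  obtain ⟨φ, hφ, hφx⟩ := exists_measurePreserving_split (k + 1) u hu
  set T : Set (ℝ × EuclideanSpace ℝ (Fin (k + 1))) :=
    {p | c * √(p.1 ^ 2 + ‖p.2‖ ^ 2) < p.1 ∧ p.1 ^ 2 + ‖p.2‖ ^ 2 < 1} with hT
  have hTm : MeasurableSet T := by
    refine ((isOpen_lt ?_ ?_).and (isOpen_lt ?_ ?_)).measurableSet <;> fun_prop
  have hK : ballSector (k + 2) c u = φ ⁻¹' T := by
    ext y
    have hy := (hφx y).2
    rw [(hφx y).1] at hy
    simp only [ballSector, hT, mem_ofPred_eq, mem_preimage, (hφx y).1, ← hy,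
      Real.sqrt_sq (norm_nonneg y), sq_lt_one_iff₀ (norm_nonneg y)]
  rw [hK, hφ.measure_preimage hTm.nullMeasurableSet, Measure.volume_eq_prod,
    Measure.prod_apply hTm]
  have hlow : ∀ s ∈ Ioc 0 c, Metric.ball 0 (s * (√x / c)) ⊆ Prod.mk s ⁻¹' T := by
    rintro s ⟨hs0, hsc⟩ y hy
    have hcp : 0 < c := hs0.trans_le hsc
    rw [mem_ball_zero_iff, ← mul_div_assoc, lt_div_iff₀ hcp] at hy
    have hy2 : (‖y‖ * c) ^ 2 < (s * √x) ^ 2 := by gcongr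
    rw [mul_pow, mul_pow, Real.sq_sqrt hx0, hc2] at hy2
    have hlt : c ^ 2 * (s ^ 2 + ‖y‖ ^ 2) < s ^ 2 := by rw [hc2]; nlinarith
    refine ⟨?_, ?_⟩
    · refine lt_of_pow_lt_pow_left₀ 2 hs0.le ?_
      change (c * √(s ^ 2 + ‖y‖ ^ 2)) ^ 2 < s ^ 2
      rwa [mul_pow, Real.sq_sqrt (x := s ^ 2 + ‖y‖ ^ 2) (by positivity)]
    · have : s ^ 2 ≤ c ^ 2 := by gcongr
      by_contra! hcon
      have : 0 < c ^ 2 := by positivity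
      nlinarith
  have hhigh : ∀ s ∈ Ioc c 1, Metric.ball 0 √(1 - s ^ 2) ⊆ Prod.mk s ⁻¹' T := by
    rintro s ⟨hsc, hs1⟩ y hy
    have hs0 : 0 < s := hc0.trans_lt hsc
    rw [mem_ball_zero_iff, Real.lt_sqrt (norm_nonneg y)] at hy
    have hlt : s ^ 2 + ‖y‖ ^ 2 < 1 := by linarith
    refine ⟨?_, hlt⟩
    have : √(s ^ 2 + ‖y‖ ^ 2) ≤ 1 := Real.sqrt_le_one.2 hlt.le
    change c * √(s ^ 2 + ‖y‖ ^ 2) < s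
    nlinarith
  have hI1 : ∫ s in (0 : ℝ)..c, (s * (√x / c)) ^ (k + 1) = √x ^ (k + 1) * c / ((k + 1 : ℕ) + 1) := by
    simp_rw [mul_pow]
    rw [intervalIntegral.integral_mul_const, integral_pow]
    rcases hc0.eq_or_lt with h | h
    · simp [← h]
    · push_cast
      rw [div_pow, zero_pow (Nat.succ_ne_zero _), sub_zero]
      field_simp
      ring
  have hn1 : 0 ≤ ∫ s in (0 : ℝ)..c, (s * (√x / c)) ^ (k + 1) := by rw [hI1]; positivity
  have hn2 : 0 ≤ ∫ s in c..1, √(1 - s ^ 2) ^ (k + 1) :=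
    intervalIntegral.integral_nonneg hc1 fun s _ => by positivity
  calc _ =
        (∫⁻ s in Ioc 0 c, volume (Metric.ball (0 : EuclideanSpace ℝ (Fin (k + 1))) (s * (√x / c)))) +
        ∫⁻ s in Ioc c 1, volume (Metric.ball (0 : EuclideanSpace ℝ (Fin (k + 1))) √(1 - s ^ 2)) := by
        rw [lintegral_volume_ball k hc0 (by fun_prop) (fun s hs => by have := hs.1; positivity),
          lintegral_volume_ball k hc1 (by fun_prop) (fun s hs => by positivity), ← add_mul,
          ← ENNReal.ofReal_add hn1 hn2, hI1, sectorVolume]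
    _ ≤ (∫⁻ s in Ioc 0 c, volume (Prod.mk s ⁻¹' T)) + ∫⁻ s in Ioc c 1, volume (Prod.mk s ⁻¹' T) :=
        add_le_add
          (setLIntegral_mono' measurableSet_Ioc fun s hs => measure_mono (hlow s hs))
          (setLIntegral_mono' measurableSet_Ioc fun s hs => measure_mono (hhigh s hs))
    _ = ∫⁻ s in Ioc 0 c ∪ Ioc c 1, volume (Prod.mk s ⁻¹' T) :=
        (lintegral_union measurableSet_Ioc (Ioc_disjoint_Ioc_of_le le_rfl)).symm
    _ ≤ _ := setLIntegral_le_lintegral _ _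

theorem volume_unit_ball_eq (k : ℕ) :
    volume (Metric.ball (0 : EuclideanSpace ℝ (Fin (k + 2))) 1) =
      ENNReal.ofReal (2 * sectorVolume (k + 1) 1) *
        volume (Metric.ball (0 : EuclideanSpace ℝ (Fin (k + 1))) 1) := by
  obtain ⟨φ, hφ, hφx⟩ := exists_measurePreserving_split (k + 1)
    (EuclideanSpace.single 0 1) (by simp)
  set T : Set (ℝ × EuclideanSpace ℝ (Fin (k + 1))) := {p | p.1 ^ 2 + ‖p.2‖ ^ 2 < 1} with hT
  have hTm : MeasurableSet T := (isOpen_lt (by fun_prop) (by fun_prop)).measurableSet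
  have hK : Metric.ball (0 : EuclideanSpace ℝ (Fin (k + 2))) 1 = φ ⁻¹' T := by
    ext y
    simp only [mem_ball_zero_iff, hT, mem_ofPred_eq, mem_preimage, ← (hφx y).2,
      sq_lt_one_iff₀ (norm_nonneg y)]
  have hslice : ∀ s : ℝ, Prod.mk s ⁻¹' T = Metric.ball 0 √(1 - s ^ 2) := by
    intro s
    ext y
    simp only [hT, mem_ofPred_eq, mem_preimage, mem_ball_zero_iff, Real.lt_sqrt (norm_nonneg y)]
    constructor <;> intro h <;> linarith
  have hsupp : Function.support
      (fun s : ℝ => volume (Metric.ball (0 : EuclideanSpace ℝ (Fin (k + 1))) √(1 - s ^ 2))) ⊆ Ioc (-1) 1 := by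
    intro s hs
    by_contra hcon
    apply hs
    have : 1 - s ^ 2 ≤ 0 := by
      rw [mem_Ioc, not_and_or, not_lt, not_le] at hcon
      rcases hcon with h | h <;> nlinarith
    simp [Real.sqrt_eq_zero_of_nonpos this]
  have hc := continuous_sqrt_one_sub_sq_pow (k + 1)
  have hsymm : ∫ s in (-1 : ℝ)..1, √(1 - s ^ 2) ^ (k + 1) =
      2 * ∫ s in (0 : ℝ)..1, √(1 - s ^ 2) ^ (k + 1) := by
    rw [← intervalIntegral.integral_add_adjacent_intervals (hc.intervalIntegrable (-1) 0)
      (hc.intervalIntegrable 0 1)]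
    have := intervalIntegral.integral_comp_neg (a := 0) (b := 1)
      (fun s : ℝ => √(1 - s ^ 2) ^ (k + 1))
    simp only [neg_sq, neg_zero] at this
    rw [← this, two_mul]
  rw [hK, hφ.measure_preimage hTm.nullMeasurableSet, Measure.volume_eq_prod,
    Measure.prod_apply hTm]
  simp_rw [hslice]
  rw [← setLIntegral_eq_of_support_subset hsupp, lintegral_volume_ball k (by norm_num) (by fun_prop)
    (fun s hs => by positivity), hsymm]
  simp [sectorVolume]

theorem disjoint_ballSector {n : ℕ} {c : ℝ} (hc : 0 ≤ c) {u v : EuclideanSpace ℝ (Fin n)}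
    (hu : ‖u‖ = 1) (hv : ‖v‖ = 1) (huv : ⟪u, v⟫ ≤ 2 * c ^ 2 - 1) :
    Disjoint (ballSector n c u) (ballSector n c v) := by
  rw [Set.disjoint_left]
  rintro x ⟨hxu, -⟩ ⟨hxv, -⟩
  have h1 : ‖u + v‖ ≤ 2 * c := by
    refine le_of_sq_le_sq ?_ (by positivity)
    rw [norm_add_sq_real, hu, hv]
    linarith
  have h2 : ⟪u + v, x⟫ ≤ ‖u + v‖ * ‖x‖ := real_inner_le_norm _ _
  rw [inner_add_left] at h2
  nlinarith [norm_nonneg x]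

theorem card_mul_sectorVolume_le (k : ℕ) {x : ℝ} (hx0 : 0 ≤ x) (hx1 : x ≤ 1)
    {C : Finset (EuclideanSpace ℝ (Fin (k + 2)))} (hC : IsSphericalCode (k + 2) (1 - 2 * x) C) :
    C.card * sectorVolume (k + 1) x ≤ 2 * sectorVolume (k + 1) 1 := by
  set ω := volume (Metric.ball (0 : EuclideanSpace ℝ (Fin (k + 1))) 1)
  have hω0 : ω ≠ 0 := (Metric.measure_ball_pos volume _ one_pos).ne'
  have hω1 : ω ≠ ⊤ := measure_ball_lt_top.ne
  have hpos : 0 ≤ sectorVolume (k + 1) 1 := by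
    simpa [sectorVolume] using
      intervalIntegral.integral_nonneg (μ := volume) (f := fun s : ℝ => √(1 - s ^ 2) ^ (k + 1))
        zero_le_one fun s _ => by positivity
  have hc2 : √(1 - x) ^ 2 = 1 - x := Real.sq_sqrt (by linarith)
  have hdisj : (C : Set (EuclideanSpace ℝ (Fin (k + 2)))).PairwiseDisjoint
      (ballSector (k + 2) √(1 - x)) := fun u hu v hv huv =>
    disjoint_ballSector (Real.sqrt_nonneg _) (hC.1 u hu) (hC.1 v hv)
      ((hC.2 u hu v hv huv).trans (by rw [hc2]; linarith))
  have h : C.card * (ENNReal.ofReal (sectorVolume (k + 1) x) * ω) ≤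
      ENNReal.ofReal (2 * sectorVolume (k + 1) 1) * ω := by
    calc _ = ∑ u ∈ C, ENNReal.ofReal (sectorVolume (k + 1) x) * ω := by
          rw [Finset.sum_const, nsmul_eq_mul]
      _ ≤ ∑ u ∈ C, volume (ballSector (k + 2) √(1 - x) u) :=
          Finset.sum_le_sum fun u hu => ofReal_sectorVolume_mul_le k hx0 hx1 (hC.1 u hu)
      _ = volume (⋃ u ∈ C, ballSector (k + 2) √(1 - x) u) :=
          (measure_biUnion_finset hdisj fun u _ => measurableSet_ballSector _ _ u).symm
      _ ≤ volume (Metric.ball (0 : EuclideanSpace ℝ (Fin (k + 2))) 1) :=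
          measure_mono (iUnion₂_subset fun u _ y hy => mem_ball_zero_iff.2 hy.2)
      _ = _ := volume_unit_ball_eq k
  rw [← mul_assoc, ENNReal.mul_le_mul_iff_left hω0 hω1, ← ENNReal.ofReal_natCast,
    ← ENNReal.ofReal_mul (Nat.cast_nonneg _)] at h
  exact (ENNReal.ofReal_le_ofReal_iff (by positivity)).1 h

/-- Theorem 3.1: upper bound for the kissing number in spherical space,
in terms of spherical codes. -/
theorem upper_bound_kappa_S (n : ℕ) (hn : 2 ≤ n) (r : ℝ)
    (hr0 : 0 ≤ r) (hr : r ≤ Real.pi / 3)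
    (C : Finset (EuclideanSpace ℝ (Fin n)))
    (hC : IsSphericalCode n (Real.cos (2 * r) / (1 + Real.cos (2 * r))) C) :
    (C.card : ℝ) ≤
      2 * incBeta 1 ((n - 1) / 2) (1 / 2) /
        incBeta ((1 / Real.cos r) ^ 2 / 4) ((n - 1) / 2) (1 / 2) := by
  obtain ⟨k, rfl⟩ := Nat.exists_eq_add_of_le' hn
  have hcos : 1 / 2 ≤ Real.cos r := by
    rw [← Real.cos_pi_div_three]
    exact Real.cos_le_cos_of_nonneg_of_le_pi hr0 (by linarith [Real.pi_pos]) hr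
  have hcos0 : 0 < Real.cos r := by linarith
  have ht : Real.cos (2 * r) / (1 + Real.cos (2 * r)) =
      1 - 2 * ((1 / Real.cos r) ^ 2 / 4) := by
    rw [Real.cos_two_mul]
    field_simp
    ring
  rw [ht] at hC
  have hx0 : 0 < (1 / Real.cos r) ^ 2 / 4 := by positivity
  have hx1 : (1 / Real.cos r) ^ 2 / 4 ≤ 1 := by
    have : 1 / Real.cos r ≤ 2 := by rw [div_le_iff₀ hcos0]; linarith
    have h0 : 0 ≤ 1 / Real.cos r := by positivity
    nlinarith
  have h := card_mul_sectorVolume_le k hx0.le hx1 hC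
  rw [sectorVolume_eq_incBeta k hx0.le hx1, sectorVolume_eq_incBeta k zero_le_one le_rfl,
    mul_left_comm, mul_left_comm 2, mul_le_mul_iff_of_pos_left (by positivity)] at h
  have hn' : (((k + 2 : ℕ) : ℝ) - 1) / 2 = (k + 1) / 2 := by push_cast; ring
  rw [hn', le_div_iff₀ (incBeta_pos k hx0 hx1)]
  exact h
end
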